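/- arXiv:dg-ga/9612017 — 3 statements merged into one kernel-verified Lean document; each statement's English description precedes it below -/
import Mathlib

section
/- Let R be a commutative ring and n ≥ 1. Every R-linear derivation D of the matrix algebra M_n(R) is inner: there exists γ ∈ M_n(R) such that D(S) = γS − Sγ for all S ∈ M_n(R). -/
open Matrix

/-- Over any commutative ring `R`, every `R`-linear derivation of
the matrix algebra `M_n(R)` (`n ≥ 1`) is inner. -/
theorem matrix_derivation_over_commRing_is_inner
    (R : Type*) [CommRing R] (n : ℕ) (hn : 1 ≤ n)
    (D : Matrix (Fin n) (Fin n) R →ₗ[R] Matrix (Fin n) (Fin n) R)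
    (hD : ∀ A B : Matrix (Fin n) (Fin n) R, D (A * B) = D A * B + A * D B) :
    ∃ γ : Matrix (Fin n) (Fin n) R,
      ∀ S : Matrix (Fin n) (Fin n) R, D S = γ * S - S * γ := by
  let z : Fin n := ⟨0, hn⟩
  refine ⟨∑ i, D (single i z 1) * single z i 1, fun S => ?_⟩
  have h1 : ∀ i, S * single i z (1 : R) = ∑ k, S k i • single k z (1 : R) := by
    intro i
    ext a b
    simp only [Matrix.mul_apply, Matrix.sum_apply, Matrix.smul_apply, single_apply, smul_eq_mul]
    by_cases hb : z = b <;> simp [hb]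
  have h2 : ∀ k, single z k (1 : R) * S = ∑ i, S k i • single z i (1 : R) := by
    intro i
    ext a b
    simp only [Matrix.mul_apply, Matrix.sum_apply, Matrix.smul_apply, single_apply, smul_eq_mul]
    by_cases hb : z = a <;> simp [hb]
  have h3 : ∀ i, S * (D (single i z 1) * single z i 1)
      = D (S * single i z 1) * single z i 1 - D S * single i i 1 := by
    intro i
    rw [hD, add_mul, Matrix.mul_assoc (D S), single_mul_single_same, Matrix.mul_assoc S, mul_one]
    abel
  have h4 : ∑ i, single i i (1 : R) = (1 : Matrix (Fin n) (Fin n) R) := sum_single_one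
  have h5 : ∑ i, D (S * single i z 1) * single z i 1
      = ∑ k, D (single k z 1) * (single z k 1 * S) := by
    simp only [h1, h2, map_sum, map_smul, Finset.sum_mul, Finset.mul_sum, smul_mul_assoc,
      mul_smul_comm]
    exact Finset.sum_comm
  rw [Finset.mul_sum, Finset.sum_mul, Finset.sum_congr rfl fun i _ => h3 i,
    Finset.sum_sub_distrib, h5, ← Finset.mul_sum, h4, mul_one]
  simp only [Matrix.mul_assoc]
  abel
end

section
/- Let R be a commutative ring and n ≥ 1. For every additive derivation D of M_n(R) there is a unique additive derivation δ of R with D(r·1) = δ(r)·1 for all r ∈ R (restriction to the center). The resulting restriction map from derivations of M_n(R) to derivations of R is surjective — the entrywise application of a derivation δ of R to a matrix is an additive derivation of M_n(R) restricting to δ — and its kernel consists exactly of the inner derivations S ↦ γS − Sγ, γ ∈ M_n(R). -/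
open Matrix

/-- For `n ≥ 1` and a commutative ring `R`:
(a) every additive derivation `D` of `M_n(R)` restricts on the center (the
scalar matrices `r • 1`) to a unique additive derivation `δ` of `R`;
(b) the restriction map is surjective: entrywise application of an additive
derivation `δ` of `R` is an additive derivation of `M_n(R)` restricting to `δ`;
(c) its kernel consists exactly of the inner derivations. -/
theorem matrix_additive_derivation_restriction
    (R : Type*) [CommRing R] (n : ℕ) (hn : 1 ≤ n)
    (D : Matrix (Fin n) (Fin n) R →+ Matrix (Fin n) (Fin n) R)
    (hD : ∀ A B : Matrix (Fin n) (Fin n) R, D (A * B) = D A * B + A * D B) :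
    (∃! δ : R →+ R,
      (∀ r s : R, δ (r * s) = δ r * s + r * δ s) ∧
      ∀ r : R, D (r • (1 : Matrix (Fin n) (Fin n) R)) = δ r • 1) ∧
    (∀ δ : R →+ R, (∀ r s : R, δ (r * s) = δ r * s + r * δ s) →
      ((∀ A B : Matrix (Fin n) (Fin n) R,
          (A + B).map ⇑δ = A.map ⇑δ + B.map ⇑δ) ∧
       (∀ A B : Matrix (Fin n) (Fin n) R,
          (A * B).map ⇑δ = (A.map ⇑δ) * B + A * (B.map ⇑δ)) ∧
       (∀ r : R, (r • (1 : Matrix (Fin n) (Fin n) R)).map ⇑δ = δ r • 1))) ∧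
    ((∀ r : R, D (r • (1 : Matrix (Fin n) (Fin n) R)) = 0) ↔
      ∃ γ : Matrix (Fin n) (Fin n) R,
        ∀ S : Matrix (Fin n) (Fin n) R, D S = γ * S - S * γ) := by
  let z : Fin n := ⟨0, hn⟩
  have hcomm : ∀ (r : R) (A : Matrix (Fin n) (Fin n) R), A * D (r • 1) = D (r • 1) * A := by
    intro r A
    have h1 := hD (r • 1) A
    have h2 := hD A (r • 1)
    have h3 : (r • (1 : Matrix (Fin n) (Fin n) R)) * A = A * (r • 1) := by simp
    rw [h3, h2] at h1
    simp only [mul_smul_comm, smul_mul_assoc, mul_one, one_mul] at h1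
    rw [add_comm] at h1
    exact add_right_cancel h1
  have hscal : ∀ r : R, D (r • 1) = (D (r • 1) z z) • (1 : Matrix (Fin n) (Fin n) R) := by
    intro r
    have key : ∀ i j : Fin n, D (r • 1) i j = if i = j then D (r • 1) z z else 0 := by
      intro i j
      have h := congrFun (congrFun (hcomm r (Matrix.single z i 1)) z) j
      rw [Matrix.single_mul_apply_same, one_mul] at h
      rw [h]
      by_cases hij : i = j
      · subst hij
        simp
      · rw [Matrix.mul_single_apply_of_ne _ _ _ _ _ (Ne.symm hij)]
        simp [hij]
    ext i j
    rw [key i j]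
    simp [Matrix.smul_apply, Matrix.one_apply]
  have hinj : ∀ a b : R, a • (1 : Matrix (Fin n) (Fin n) R) = b • 1 → a = b := by
    intro a b h
    have := congrFun (congrFun h z) z
    simpa using this
  refine ⟨?_, ?_, ?_⟩
  · let δ : R →+ R :=
      { toFun := fun r => D (r • 1) z z
        map_zero' := by simp
        map_add' := by intro a b; simp [add_smul] }
    have hδ : ∀ r : R, D (r • (1 : Matrix (Fin n) (Fin n) R)) = δ r • 1 := hscal
    refine ⟨δ, ⟨?_, hδ⟩, ?_⟩
    · intro r s
      apply hinj
      have h : (r * s) • (1 : Matrix (Fin n) (Fin n) R) = (r • 1) * (s • 1) := by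
        simp [smul_smul, mul_comm]
      rw [← hδ, h, hD, hδ, hδ]
      simp [smul_smul, add_smul, mul_comm]
    · rintro δ' ⟨-, h'⟩
      ext r
      apply hinj
      rw [← hδ, ← h']
  · intro δ hδ
    have h1 : δ 1 = 0 := by simpa using hδ 1 1
    refine ⟨?_, ?_, ?_⟩
    · intro A B
      ext i j
      simp
    · intro A B
      ext i j
      simp [Matrix.mul_apply, hδ, Finset.sum_add_distrib]
    · intro r
      ext i j
      by_cases hij : i = j <;> simp [Matrix.one_apply, hij]
  · constructor
    · intro h0
      have hlin : ∀ (r : R) (A : Matrix (Fin n) (Fin n) R), D (r • A) = r • D A := by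
        intro r A
        have h := hD (r • 1) A
        simpa [h0] using h
      have hone : ∑ i : Fin n, Matrix.single i z (1 : R) * Matrix.single z i 1 = 1 := by
        simp [Matrix.sum_single_one]
      have hl : ∀ (S : Matrix (Fin n) (Fin n) R) (i : Fin n),
          S * Matrix.single i z 1 = ∑ j, S j i • Matrix.single j z (1 : R) := by
        intro S i
        ext a b
        simp [Matrix.mul_apply, Matrix.sum_apply, Matrix.single_apply]
        by_cases hb : z = b <;> simp [hb]
      have hr : ∀ (S : Matrix (Fin n) (Fin n) R) (j : Fin n),
          Matrix.single z j 1 * S = ∑ i, S j i • Matrix.single z i (1 : R) := by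
        intro S i
        ext a b
        simp [Matrix.mul_apply, Matrix.sum_apply, Matrix.single_apply]
        by_cases hb : z = a <;> simp [hb]
      refine ⟨∑ i, D (Matrix.single i z 1) * Matrix.single z i 1, fun S => ?_⟩
      have e1 : S * ∑ i, D (Matrix.single i z 1) * Matrix.single z i 1
          = ∑ i, D (S * Matrix.single i z 1) * Matrix.single z i 1 - D S := by
        have : D S = ∑ i, D S * (Matrix.single i z (1 : R) * Matrix.single z i 1) := by
          rw [← Finset.mul_sum, hone, mul_one]
        rw [eq_sub_iff_add_eq]
        conv_lhs => rw [this]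
        rw [Finset.mul_sum, ← Finset.sum_add_distrib]
        refine Finset.sum_congr rfl fun i _ => ?_
        rw [hD S, add_mul, mul_assoc, mul_assoc, add_comm]
      have e2 : (∑ i, D (Matrix.single i z 1) * Matrix.single z i 1) * S
          = ∑ i, D (S * Matrix.single i z 1) * Matrix.single z i 1 := by
        rw [Finset.sum_mul]
        simp only [mul_assoc, hr, hl, map_sum, hlin, Finset.mul_sum, Finset.sum_mul,
          mul_smul_comm, smul_mul_assoc]
        exact Finset.sum_comm
      rw [e1, e2]
      abel
    · rintro ⟨γ, hγ⟩ r
      rw [hγ]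
      simp
end

section
/- Let R be a commutative unital ℂ-algebra and n ≥ 1. Every ℂ-linear derivation D of M_n(R) can be written uniquely as the sum of the entrywise application of a ℂ-linear derivation δ of R and an inner derivation ad_γ with γ ∈ M_n(R) traceless (Tr γ = 0): D(S) = (δ(S_{ij}))_{ij} + γS − Sγ for all S ∈ M_n(R), and the pair (δ, γ) with Tr γ = 0 is unique. -/
open Matrix

theorem aux_exists {R : Type*} [CommRing R] [Algebra ℂ R] {n : ℕ} (z : Fin n)
    (D : Matrix (Fin n) (Fin n) R →ₗ[ℂ] Matrix (Fin n) (Fin n) R)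
    (hD : ∀ A B : Matrix (Fin n) (Fin n) R, D (A * B) = D A * B + A * D B)
    (h0 : ∀ i j, D (single i j 1) = 0) :
    ∃ δ : R →ₗ[ℂ] R, (∀ r s : R, δ (r * s) = δ r * s + r * δ s) ∧
      ∀ S : Matrix (Fin n) (Fin n) R, D S = S.map δ := by
  let δ : R →ₗ[ℂ] R :=
    { toFun := fun r => D (single z z r) z z
      map_add' := by intro r s; rw [single_add, map_add]; rfl
      map_smul' := by intro c r; rw [← smul_single, map_smul]; rfl }
  have key : ∀ i j r, D (single i j r) = single i j (δ r) := by
    intro i j r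
    have h : single i j r = single i z (1 : R) * single z z r * single z j (1 : R) := by
      simp
    rw [h, hD, hD, h0, h0, zero_mul, zero_add, mul_zero, add_zero, single_mul_mul_single]
    simp [δ]
  refine ⟨δ, ?_, ?_⟩
  · intro r s
    have h := hD (single z z r) (single z z s)
    rw [single_mul_single_same, key, key, key, single_mul_single_same,
      single_mul_single_same] at h
    simpa using congrFun (congrFun h z) z
  · intro S
    conv_lhs => rw [matrix_eq_sum_single S]
    rw [matrix_eq_sum_single (S.map δ)]
    simp [map_sum, key]

theorem aux_inner {R : Type*} [CommRing R] [Algebra ℂ R] {n : ℕ} (z : Fin n)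
    (D : Matrix (Fin n) (Fin n) R →ₗ[ℂ] Matrix (Fin n) (Fin n) R)
    (hD : ∀ A B : Matrix (Fin n) (Fin n) R, D (A * B) = D A * B + A * D B) :
    ∃ γ : Matrix (Fin n) (Fin n) R, ∀ i j, D (single i j 1) =
      γ * single i j 1 - single i j 1 * γ := by
  refine ⟨∑ k, D (single k z 1) * single z k 1, fun i j => ?_⟩
  have h1 : (∑ k, D (single k z (1 : R)) * single z k 1) * single i j 1
      = D (single i z 1) * single z j 1 := by
    rw [Finset.sum_mul, Finset.sum_eq_single i]
    · rw [mul_assoc, single_mul_single_same, one_mul]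
    · intro k _ hk
      rw [mul_assoc, single_mul_single_of_ne _ _ _ _ hk, mul_zero]
    · simp
  have h2 : single i j 1 * (∑ k, D (single k z (1 : R)) * single z k 1)
      = D (single i z 1) * single z j 1 - D (single i j 1) := by
    have h3 : ∀ k, single i j 1 * (D (single k z (1 : R)) * single z k 1) =
        D (single i j 1 * single k z 1) * single z k 1
          - D (single i j 1) * single k k 1 := by
      intro k
      rw [hD, add_mul, mul_assoc (D _), single_mul_single_same, one_mul, mul_assoc]
      abel
    rw [Finset.mul_sum, Finset.sum_congr rfl (fun k _ => h3 k), Finset.sum_sub_distrib,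
      ← Finset.mul_sum, sum_single_one, mul_one, Finset.sum_eq_single j]
    · rw [single_mul_single_same, one_mul]
    · intro k _ hk
      rw [single_mul_single_of_ne _ _ _ _ hk.symm, map_zero, zero_mul]
    · simp
  rw [h1, h2]; abel

theorem aux_ninj {R : Type*} [CommRing R] [Algebra ℂ R] {n : ℕ} (hn : 1 ≤ n) (c : R) :
    (n : R) * (((n : ℂ)⁻¹) • c) = c := by
  have hn' : (n : ℂ) ≠ 0 := by exact_mod_cast (by omega : n ≠ 0)
  rw [mul_smul_comm, ← nsmul_eq_mul, ← Nat.cast_smul_eq_nsmul ℂ, smul_smul,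
    inv_mul_cancel₀ hn', one_smul]

/-- For a commutative unital ℂ-algebra `R` and `n ≥ 1`, every
ℂ-linear derivation `D` of `M_n(R)` is uniquely the sum of the entrywise
application of a ℂ-linear derivation `δ` of `R` and an inner derivation
`ad_γ` with `γ` traceless. -/
theorem matrix_derivation_unique_decomposition
    (R : Type*) [CommRing R] [Algebra ℂ R] (n : ℕ) (hn : 1 ≤ n)
    (D : Matrix (Fin n) (Fin n) R →ₗ[ℂ] Matrix (Fin n) (Fin n) R)
    (hD : ∀ A B : Matrix (Fin n) (Fin n) R, D (A * B) = D A * B + A * D B) :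
    ∃! p : (R →ₗ[ℂ] R) × Matrix (Fin n) (Fin n) R,
      (∀ r s : R, p.1 (r * s) = p.1 r * s + r * p.1 s) ∧
      p.2.trace = 0 ∧
      ∀ S : Matrix (Fin n) (Fin n) R,
        D S = S.map ⇑p.1 + (p.2 * S - S * p.2) := by
  have z : Fin n := ⟨0, hn⟩
  obtain ⟨γ, hγ⟩ := aux_inner z D hD
  let D' : Matrix (Fin n) (Fin n) R →ₗ[ℂ] Matrix (Fin n) (Fin n) R :=
    D - (LinearMap.mulLeft ℂ γ - LinearMap.mulRight ℂ γ)
  have hD'a : ∀ S, D' S = D S - (γ * S - S * γ) := fun S => rfl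
  obtain ⟨δ, hδ, hS⟩ := aux_exists z D'
    (by intro A B; simp only [hD'a, hD]; noncomm_ring)
    (by intro i j; rw [hD'a, hγ, sub_self])
  refine ⟨(δ, γ - scalar (Fin n) (((n : ℂ)⁻¹) • γ.trace)), ⟨hδ, ?_, ?_⟩, ?_⟩
  · have := aux_ninj hn γ.trace
    simp only [trace_sub, scalar_apply, trace_diagonal, Finset.sum_const, Finset.card_univ,
      Fintype.card_fin, nsmul_eq_mul, this, sub_self]
  · intro S
    have hc := scalar_commute (n := Fin n) (((n : ℂ)⁻¹) • γ.trace) (fun r => mul_comm _ r) S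
    have h := hS S
    rw [hD'a, sub_eq_iff_eq_add] at h
    simp only
    rw [h, sub_mul, mul_sub, hc.eq]
    abel
  · rintro ⟨δ', γ'⟩ ⟨hd, ht, hs⟩
    simp only at hd ht hs
    have h1 : δ' 1 = 0 := by simpa using hd 1 1
    have hcomm : γ' - γ ∈ Set.range (scalar (Fin n)) := by
      rw [mem_range_scalar_iff_commute_single']
      intro i j
      have e := hs (single i j 1)
      rw [hγ, map_single, h1, single_zero, zero_add] at e
      change _ * _ = _ * _
      rw [mul_sub, sub_mul]
      have := sub_eq_zero.mpr e
      rw [← sub_eq_zero, ← this]; abel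
    obtain ⟨c, hc⟩ := hcomm
    have hg : γ' = γ + scalar (Fin n) c := by rw [hc]; abel
    have hct : c = -(((n : ℂ)⁻¹) • γ.trace) := by
      rw [hg] at ht
      simp only [trace_add, scalar_apply, trace_diagonal, Finset.sum_const, Finset.card_univ,
        Fintype.card_fin, nsmul_eq_mul] at ht
      have ht' : γ.trace = -((n : R) * c) := eq_neg_of_add_eq_zero_left ht
      rw [ht', smul_neg, neg_neg, ← mul_smul_comm, aux_ninj hn]
    have hδδ : δ' = δ := by
      ext r
      have e := hs (single z z r)
      have h := hS (single z z r)
      have hcc := scalar_commute (n := Fin n) c (fun r => mul_comm _ r) (single z z r)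
      rw [hD'a, e, hg, add_mul, mul_add, hcc.eq, map_single, map_single] at h
      have h' : single z z (δ' r) = single z z (δ r) := by rw [← h]; abel
      simpa using congrFun (congrFun h' z) z
    rw [hδδ, hg, hct, map_neg, ← sub_eq_add_neg]
end
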